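/- arXiv:2011.08289 — 3 statements merged into one kernel-verified Lean document; each statement's English description precedes it below -/
import Mathlib

section
/- Let n ≥ 2 (positive definite case p = n, q = 0). Let X_0 ∈ ℝ^{n+1}, R > 0, and let f be a C¹ 𝒜_n-valued function on a neighborhood of the closed ball {X : ‖X−X_0‖ ≤ R} satisfying ∇⁺_{n,0} f = ∂f/∂x_0 + Σ_{j=1}^n e_j ∂f/∂x_j = 0 there. Then ∫_{S_R(X_0)} ( (X−X_0)⁺ / ‖X−X_0‖^{n+1} ) · ((X−X_0)/R) · f(X) dS(X) = ω_n f(X_0), where S_R(X_0) = {X : ‖X−X_0‖ = R} carries its Euclidean surface measure dS. Moreover, if Y_0 ∈ ℝ^{n+1} satisfies ‖Y_0 − X_0‖ > R, then ∫_{S_R(X_0)} ( (X−Y_0)⁺ / ‖X−Y_0‖^{n+1} ) · ((X−X_0)/R) · f(X) dS(X) = 0. -/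
open scoped BigOperators
open MeasureTheory

noncomputable section

/-- The `j`-th partial derivative of a function on Euclidean space. -/
def pdE {n : ℕ} {A : Type*} [NormedAddCommGroup A] [NormedSpace ℝ A]
    (f : EuclideanSpace ℝ (Fin (n + 1)) → A) (j : Fin (n + 1))
    (X : EuclideanSpace ℝ (Fin (n + 1))) : A :=
  fderiv ℝ f X (EuclideanSpace.single j 1)

/-- The left Dirac operator `∇⁺_{n,0} f = ∑_j e_j ∂f/∂x_j` (with `e 0 = 1`). -/
def diracPlusE {n : ℕ} {A : Type*} [NormedRing A] [NormedAlgebra ℝ A]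
    (e : Fin (n + 1) → A) (f : EuclideanSpace ℝ (Fin (n + 1)) → A)
    (X : EuclideanSpace ℝ (Fin (n + 1))) : A :=
  ∑ j, e j * pdE f j X

/-- The embedding `ℝ^{n+1} → 𝒜_n`, `Y ↦ ∑_j y_j e_j`. -/
def embE {n : ℕ} {A : Type*} [NormedRing A] [NormedAlgebra ℝ A]
    (e : Fin (n + 1) → A) (Y : EuclideanSpace ℝ (Fin (n + 1))) : A :=
  ∑ j, Y j • e j

/-- The Clifford conjugate `Y⁺ = y_0 e_0 - ∑_{j≥1} y_j e_j`. -/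
def embPlusE {n : ℕ} {A : Type*} [NormedRing A] [NormedAlgebra ℝ A]
    (e : Fin (n + 1) → A) (Y : EuclideanSpace ℝ (Fin (n + 1))) : A :=
  ∑ j : Fin (n + 1), (if (j : ℕ) = 0 then Y j else -Y j) • e j

/-- The surface integral over the sphere `S_R(X₀) ⊆ ℝ^{n+1}` with respect to the
Euclidean surface measure: it is parametrized by the unit sphere via
`ω ↦ X₀ + R ω`, with scaling factor `R^n`. -/
def sphereIntegral {n : ℕ} {A : Type*} [NormedAddCommGroup A] [NormedSpace ℝ A]
    (R : ℝ) (X₀ : EuclideanSpace ℝ (Fin (n + 1)))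
    (F : EuclideanSpace ℝ (Fin (n + 1)) → A) : A :=
  (R ^ n) • ∫ ω : Metric.sphere (0 : EuclideanSpace ℝ (Fin (n + 1))) 1,
    F (X₀ + R • (ω : EuclideanSpace ℝ (Fin (n + 1)))) ∂(volume.toSphere)

/-- `ω_n = 2π^{(n+1)/2} / Γ((n+1)/2)`, the `n`-dimensional volume of the unit
`n`-sphere in `ℝ^{n+1}`. -/
def omegaN (n : ℕ) : ℝ :=
  2 * Real.pi ^ (((n : ℝ) + 1) / 2) / Real.Gamma (((n : ℝ) + 1) / 2)


theorem polarE {n : ℕ} {A : Type*} [NormedAddCommGroup A] [NormedSpace ℝ A] [CompleteSpace A] (f : EuclideanSpace ℝ (Fin (n+1)) → A) (hf : Integrable f volume) :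
    ∫ x, f x = ∫ r in Set.Ioi (0:ℝ), r ^ n •
      ∫ ω : Metric.sphere (0 : EuclideanSpace ℝ (Fin (n + 1))) 1, f (r • (ω : EuclideanSpace ℝ (Fin (n + 1)))) ∂(volume.toSphere) := by
  have mp := (volume : Measure (EuclideanSpace ℝ (Fin (n+1)))).measurePreserving_homeomorphUnitSphereProd
  have hd : Module.finrank ℝ (EuclideanSpace ℝ (Fin (n+1))) - 1 = n := by simp
  rw [hd] at mp
  have key := mp.integral_comp (Homeomorph.measurableEmbedding _)
    (fun p => f ((p.2 : ℝ) • (p.1 : EuclideanSpace ℝ (Fin (n+1)))))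
  have e1 : ∀ x : ({(0:EuclideanSpace ℝ (Fin (n+1)))}ᶜ : Set _),
      (((homeomorphUnitSphereProd _ x).2 : ℝ) • ((homeomorphUnitSphereProd _ x).1 : EuclideanSpace ℝ (Fin (n+1)))) = x := by
    intro x
    have : ‖(x : EuclideanSpace ℝ (Fin (n+1)))‖ ≠ 0 := norm_ne_zero_iff.2 x.2
    simp [smul_smul, this]
  simp only [e1] at key
  have hint : Integrable (fun p : Metric.sphere (0 : EuclideanSpace ℝ (Fin (n + 1))) 1 × Set.Ioi (0:ℝ) => f ((p.2 : ℝ) • (p.1 : EuclideanSpace ℝ (Fin (n+1)))))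
      ((volume : Measure (EuclideanSpace ℝ (Fin (n+1)))).toSphere.prod (Measure.volumeIoiPow n)) := by
    rw [← mp.integrable_comp_emb (Homeomorph.measurableEmbedding _)]
    simp only [Function.comp_def, e1]
    exact (integrableOn_iff_comap_subtypeVal (measurableSet_singleton _).compl).1 hf.integrableOn
  rw [integral_prod_symm _ hint, integral_subtype_comap (measurableSet_singleton _).compl, restrict_compl_singleton] at key
  rw [key, Measure.volumeIoiPow]
  rw [integral_withDensity_eq_integral_toReal_smul (by fun_prop) (by simp),
    ← integral_subtype_comap measurableSet_Ioi (fun r : ℝ => r ^ n •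
      ∫ ω : Metric.sphere (0 : EuclideanSpace ℝ (Fin (n + 1))) 1, f (r • (ω : EuclideanSpace ℝ (Fin (n + 1)))) ∂(volume.toSphere))]
  refine integral_congr_ae (.of_forall fun r => ?_)
  have := r.2.out.le
  simp only
  rw [ENNReal.toReal_ofReal (by positivity)]

theorem dbr {A : Type*} [NormedAddCommGroup A] [NormedSpace ℝ A] [CompleteSpace A]
    (R' : ℝ) (hR' : 0 < R') (g : ℝ → A) (hg : ContinuousOn g (Set.Ioo 0 R'))
    (h : ∀ H : ℝ → ℝ, ContDiff ℝ (⊤ : ℕ∞) H → HasCompactSupport H → tsupport H ⊆ Set.Ioo 0 R' →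
      ∫ r, deriv H r • g r = 0) : ∃ c, ∀ r ∈ Set.Ioo 0 R', g r = c := by
  let b : ContDiffBump (R' / 2) := ⟨R' / 8, R' / 4, by positivity, by linarith⟩
  set η := b.normed volume with hη
  have ηs : ContDiff ℝ (⊤ : ℕ∞) η := b.contDiff_normed
  have ηc : HasCompactSupport η := b.hasCompactSupport_normed
  have ηt : tsupport η ⊆ Set.Ioo 0 R' := by
    rw [hη, b.tsupport_normed_eq, Real.closedBall_eq_Icc]
    intro x hx
    have : b.rOut = R' / 4 := rfl
    rw [this] at hx
    constructor <;> linarith [hx.1, hx.2]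
  have ηi : ∫ x, η x = 1 := b.integral_normed
  have cont : ∀ ψ : ℝ → ℝ, Continuous ψ → tsupport ψ ⊆ Set.Ioo 0 R' → ∀ k : ℝ → A,
      ContinuousOn k (Set.Ioo 0 R') → Continuous (fun r => ψ r • k r) := by
    intro ψ hψ ht k hk
    exact (hψ.continuousOn.smul hk).continuous_of_tsupport_subset isOpen_Ioo
      ((closure_mono (Function.support_smul_subset_left ψ k)).trans ht)
  have intg : ∀ ψ : ℝ → ℝ, Continuous ψ → HasCompactSupport ψ → tsupport ψ ⊆ Set.Ioo 0 R' →
      ∀ k : ℝ → A, ContinuousOn k (Set.Ioo 0 R') → Integrable (fun r => ψ r • k r) := by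
    intro ψ hψ hc ht k hk
    exact (cont ψ hψ ht k hk).integrable_of_hasCompactSupport hc.smul_right
  refine ⟨∫ r, η r • g r, ?_⟩
  set c := ∫ r, η r • g r with hc
  have ae := isOpen_Ioo.ae_eq_zero_of_integral_contDiff_smul_eq_zero (U := Set.Ioo 0 R')
    (f := fun r => g r - c) (μ := volume)
    ((hg.sub continuousOn_const).locallyIntegrableOn measurableSet_Ioo) (by
    intro ψ ψs ψc ψt
    set s := ∫ r, ψ r with hs
    set ρ : ℝ → ℝ := fun r => ψ r - s * η r with hρ
    have ρs : ContDiff ℝ (⊤ : ℕ∞) ρ := ψs.sub (contDiff_const.mul ηs)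
    have ρc : HasCompactSupport ρ := ψc.sub ηc.mul_left
    have ρt : tsupport ρ ⊆ Set.Ioo 0 R' := by
      refine (tsupport_sub ψ (fun r => s * η r)).trans (Set.union_subset ψt ?_)
      exact (closure_mono (Function.support_mul_subset_right _ η)).trans ηt
    have ψi : Integrable ψ := ψs.continuous.integrable_of_hasCompactSupport ψc
    have ηint : Integrable η := ηs.continuous.integrable_of_hasCompactSupport ηc
    have ρi : Integrable ρ := ρs.continuous.integrable_of_hasCompactSupport ρc
    have ρ0 : ∫ r, ρ r = 0 := by
      rw [hρ, integral_sub ψi (ηint.const_mul s), integral_const_mul, ηi]; simp [hs]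
    let H : ℝ → ℝ := fun r => ∫ t in (0:ℝ)..r, ρ t
    have Hd : ∀ r, HasDerivAt H (ρ r) r := fun r =>
      intervalIntegral.integral_hasDerivAt_right ρi.intervalIntegrable
        ρs.continuous.stronglyMeasurable.stronglyMeasurableAtFilter ρs.continuous.continuousAt
    have dH : deriv H = ρ := funext fun r => (Hd r).deriv
    have Hs : ContDiff ℝ (⊤ : ℕ∞) H :=
      contDiff_infty_iff_deriv.2 ⟨fun r => (Hd r).differentiableAt, dH ▸ ρs⟩
    obtain ⟨a, b', ha, hb, hab⟩ : ∃ a b', 0 < a ∧ b' < R' ∧ tsupport ρ ⊆ Set.Icc a b' := by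
      by_cases hne : (tsupport ρ).Nonempty
      · obtain ⟨x, hx, hx'⟩ := ρc.exists_isLeast hne
        obtain ⟨y, hy, hy'⟩ := ρc.exists_isGreatest hne
        exact ⟨x, y, (ρt hx).1, (ρt hy).2, fun z hz => ⟨hx' hz, hy' hz⟩⟩
      · exact ⟨R'/2, R'/2, by linarith, by linarith, by
          rw [Set.not_nonempty_iff_eq_empty.1 hne]; exact Set.empty_subset _⟩
    have ρz : ∀ r, r ∉ Set.Icc a b' → ρ r = 0 := fun r hr => by
      by_contra hh; exact hr (hab (subset_tsupport _ hh))
    have Hz : ∀ r, r ∉ Set.Icc a b' → H r = 0 := by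
      intro r hr
      by_cases h1 : r < a
      · have : ∀ t ∈ Set.uIcc 0 r, ρ t = 0 := fun t ht => ρz t fun ht' => by
          rcases Set.mem_uIcc.1 ht with h | h <;> linarith [h.1, h.2, ht'.1]
        simp only [H]
        rw [intervalIntegral.integral_congr (g := fun _ => 0) this]; simp
      · have hrb : b' < r := by
          by_contra h2; exact hr ⟨not_lt.1 h1, not_lt.1 h2⟩
        have e1 : ∫ t in (0:ℝ)..r, ρ t = ∫ t, ρ t := by
          apply intervalIntegral.integral_eq_integral_of_support_subset
          intro t ht
          have := hab (subset_tsupport _ ht)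
          constructor <;> linarith [this.1, this.2]
        simp only [H]; rw [e1, ρ0]
    have Ht : tsupport H ⊆ Set.Icc a b' := by
      refine closure_minimal (fun r hr => ?_) isClosed_Icc
      by_contra hh; exact hr (Hz r hh)
    have Hc : HasCompactSupport H := isCompact_Icc.of_isClosed_subset (isClosed_tsupport _) Ht
    have key := h H Hs Hc (Ht.trans fun r hr => ⟨ha.trans_le hr.1, hr.2.trans_lt hb⟩)
    rw [dH] at key
    simp only [hρ, sub_smul, mul_smul] at key
    have i1 := intg ψ ψs.continuous ψc ψt g hg
    have i2 := intg η ηs.continuous ηc ηt g hg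
    rw [integral_sub i1 (i2.fun_smul s), integral_smul, ← hc] at key
    simp only [smul_sub]
    rw [integral_sub i1 (ψi.smul_const c), integral_smul_const, ← hs]
    exact key)
  have ae' : (fun r => g r - c) =ᵐ[volume.restrict (Set.Ioo 0 R')] fun _ => 0 :=
    (ae_restrict_iff' measurableSet_Ioo).2 ae
  have := Measure.eqOn_open_of_ae_eq ae' isOpen_Ioo (hg.sub continuousOn_const) continuousOn_const
  intro r hr
  exact sub_eq_zero.1 (this hr)

theorem hasFDerivAt_normE {n : ℕ} {x : EuclideanSpace ℝ (Fin (n+1))} (hx : x ≠ 0) :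
    HasFDerivAt (fun y : EuclideanSpace ℝ (Fin (n+1)) => ‖y‖) (‖x‖⁻¹ • innerSL ℝ x) x := by
  have h1 : HasFDerivAt (fun y : EuclideanSpace ℝ (Fin (n+1)) => ‖y‖ ^ 2) (2 • innerSL ℝ x) x :=
    (hasStrictFDerivAt_norm_sq x).hasFDerivAt
  have h2 := h1.sqrt (by simpa using hx)
  simp only [Real.sqrt_sq (norm_nonneg _)] at h2
  refine h2.congr_fderiv ?_
  have : ‖x‖ ≠ 0 := norm_ne_zero_iff.2 hx
  ext v
  simp only [ContinuousLinearMap.smul_apply, smul_eq_mul, nsmul_eq_mul]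
  push_cast
  field_simp

theorem fluxE {n : ℕ} {A : Type*} [NormedAddCommGroup A] [NormedSpace ℝ A] [CompleteSpace A]
    (R' : ℝ) (hR' : 0 < R') (F : Fin (n+1) → EuclideanSpace ℝ (Fin (n+1)) → A)
    (hF : ∀ j, ContDiffOn ℝ 1 (F j) {x | 0 < ‖x‖ ∧ ‖x‖ < R'})
    (hdiv : ∀ x, 0 < ‖x‖ → ‖x‖ < R' → ∑ j, fderiv ℝ (F j) x (EuclideanSpace.single j 1) = 0) :
    ∃ c, ∀ r ∈ Set.Ioo 0 R', r ^ n • ∫ ω : Metric.sphere (0 : EuclideanSpace ℝ (Fin (n + 1))) 1,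
      ∑ j, (ω : EuclideanSpace ℝ (Fin (n + 1))) j •
        F j (r • (ω : EuclideanSpace ℝ (Fin (n + 1)))) ∂(volume.toSphere) = c := by
  set U := {x : EuclideanSpace ℝ (Fin (n+1)) | 0 < ‖x‖ ∧ ‖x‖ < R'} with hU
  have Uo : IsOpen U := (isOpen_lt continuous_const continuous_norm).inter
    (isOpen_lt continuous_norm continuous_const)
  have sph : ∀ ω : Metric.sphere (0 : EuclideanSpace ℝ (Fin (n + 1))) 1, ‖(ω : EuclideanSpace ℝ (Fin (n + 1)))‖ = 1 := by
    intro ω; simp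
  apply dbr R' hR'
  · refine ContinuousOn.smul (by fun_prop) ?_
    apply continuousOn_integral_of_compact_support isCompact_univ
    · refine continuousOn_finsetSum _ fun j _ => ?_
      refine ContinuousOn.smul (by fun_prop) ?_
      refine (hF j).continuousOn.comp (by fun_prop) ?_
      rintro ⟨r, ω⟩ ⟨hr, -⟩
      simp only [hU, Set.mem_ofPred_eq, norm_smul, sph, mul_one, Real.norm_eq_abs, abs_of_pos hr.1]
      exact hr
    · simp
  intro H Hs Hc Ht
  let φ : EuclideanSpace ℝ (Fin (n+1)) → ℝ := fun x => H ‖x‖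
  have φt : tsupport φ ⊆ U := fun x hx => Ht (tsupport_comp_subset_preimage H continuous_norm hx)
  have φc : HasCompactSupport φ := (isCompact_closedBall 0 R').of_isClosed_subset
    (isClosed_tsupport _) fun x hx => by simpa using (φt hx).2.le
  have φs : ContDiff ℝ 1 φ := by
    refine contDiff_iff_contDiffAt.2 fun x => ?_
    by_cases hx : x ∈ tsupport φ
    swap
    · exact contDiffAt_const.congr_of_eventuallyEq (notMem_tsupport_iff_eventuallyEq.1 hx)
    exact (Hs.of_le (by exact_mod_cast le_top)).contDiffAt.comp x (contDiffAt_norm ℝ (norm_pos_iff.1 (φt hx).1))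
  have φd : ∀ x ≠ 0, ∀ j, fderiv ℝ φ x (EuclideanSpace.single j 1) = deriv H ‖x‖ * (‖x‖⁻¹ * x j) := by
    intro x hx j
    have h1 : HasDerivAt H (deriv H ‖x‖) ‖x‖ :=
      ((Hs.differentiable (by simp)) _).hasDerivAt
    have h2 := h1.comp_hasFDerivAt x (hasFDerivAt_normE hx)
    have : fderiv ℝ φ x = _ := h2.fderiv
    rw [this]
    simp [EuclideanSpace.inner_single_right]
  have intg : ∀ (ψ : EuclideanSpace ℝ (Fin (n+1)) → ℝ) (k : EuclideanSpace ℝ (Fin (n+1)) → A),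
      Continuous ψ → tsupport ψ ⊆ tsupport φ → ContinuousOn k U → Integrable (fun x => ψ x • k x) := by
    intro ψ k hψ ht hk
    have : HasCompactSupport ψ := φc.of_isClosed_subset (isClosed_tsupport _) ht
    exact ((hψ.continuousOn.smul hk).continuous_of_tsupport_subset Uo
      ((closure_mono (Function.support_smul_subset_left ψ k)).trans (ht.trans φt))).integrable_of_hasCompactSupport this.smul_right
  have dts : ∀ v, tsupport (fun x => fderiv ℝ φ x v) ⊆ tsupport φ := fun v =>
    tsupport_fderiv_apply_subset ℝ v
  have dcont : ∀ v, Continuous (fun x => fderiv ℝ φ x v) := fun v =>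
    (φs.continuous_fderiv (by simp)).clm_apply continuous_const
  have i1 : ∀ j, Integrable (fun x => fderiv ℝ φ x (EuclideanSpace.single j 1) • F j x) := fun j =>
    intg _ _ (dcont _) (dts _) (hF j).continuousOn
  have i2 : ∀ j, Integrable (fun x => φ x • fderiv ℝ (F j) x (EuclideanSpace.single j 1)) := fun j =>
    intg _ _ φs.continuous subset_rfl
      (((hF j).continuousOn_fderiv_of_isOpen Uo le_rfl).clm_apply continuousOn_const)
  have ibp : ∫ x, ∑ j, fderiv ℝ φ x (EuclideanSpace.single j 1) • F j x = 0 := by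
    rw [integral_finsetSum _ fun j _ => i1 j]
    have : ∀ j, ∫ x, fderiv ℝ φ x (EuclideanSpace.single j 1) • F j x =
        - ∫ x, φ x • fderiv ℝ (F j) x (EuclideanSpace.single j 1) := by
      intro j
      rw [integral_smul_fderiv_eq_neg_fderiv_smul_of_integrable (i1 j) (i2 j)
        (intg _ _ φs.continuous subset_rfl (hF j).continuousOn)
        (fun x _ => φs.differentiable (by simp) x)
        (fun x hx => ((hF j).differentiableOn (by simp)).differentiableAt (Uo.mem_nhds (φt hx))), neg_neg]
    simp only [this]
    rw [Finset.sum_neg_distrib, ← integral_finsetSum _ fun j _ => i2 j, neg_eq_zero]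
    apply integral_eq_zero_of_ae
    refine .of_forall fun x => ?_
    simp only [← Finset.smul_sum, Pi.zero_apply]
    by_cases hx : x ∈ U
    · rw [hdiv x hx.1 hx.2, smul_zero]
    · rw [show φ x = 0 from by
        by_contra hh; exact hx (φt (subset_tsupport _ hh)), zero_smul]
  rw [polarE _ (integrable_finsetSum _ fun j _ => i1 j)] at ibp
  have dH0 : ∀ r, r ∉ Set.Ioi (0:ℝ) → deriv H r = 0 := fun r hr => by
    by_contra hh
    exact hr (Ht (tsupport_deriv_subset (𝕜 := ℝ) (subset_tsupport _ hh))).1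
  rw [← setIntegral_eq_integral_of_forall_compl_eq_zero (s := Set.Ioi 0)
    (fun r hr => by rw [dH0 r hr, zero_smul]), ← ibp]
  refine setIntegral_congr_fun measurableSet_Ioi fun r hr => ?_
  have hr : 0 < r := hr
  simp only
  rw [smul_comm, ← integral_smul]
  congr 2
  ext ω
  rw [Finset.smul_sum]
  refine Finset.sum_congr rfl fun j _ => ?_
  have hne : r • (ω : EuclideanSpace ℝ (Fin (n + 1))) ≠ 0 := by
    rw [← norm_pos_iff, norm_smul, sph, mul_one, Real.norm_eq_abs, abs_of_pos hr]; exact hr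
  rw [φd _ hne, norm_smul, sph, mul_one, Real.norm_eq_abs, abs_of_pos hr, smul_smul]
  congr 1
  simp only [PiLp.smul_apply, smul_eq_mul]
  field_simp

theorem cliffSq {n : ℕ} {A : Type*} [NormedRing A] [NormedAlgebra ℝ A]
    (e : Fin (n + 1) → A) (he0 : e 0 = 1)
    (hsq : ∀ j : Fin (n + 1), j ≠ 0 → e j * e j = -1)
    (hanti : ∀ j k : Fin (n + 1), j ≠ 0 → k ≠ 0 → j ≠ k → e j * e k = -(e k * e j))
    (x : EuclideanSpace ℝ (Fin (n + 1))) :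
    embPlusE e x * embE e x = (‖x‖ ^ 2) • (1 : A) := by
  set v : A := ∑ i : Fin n, x i.succ • e i.succ with hv
  have hP : embPlusE e x = x 0 • (1 : A) - v := by
    simp [embPlusE, Fin.sum_univ_succ, he0, hv, sub_eq_add_neg]
  have hE : embE e x = x 0 • (1 : A) + v := by
    simp [embE, Fin.sum_univ_succ, he0, hv]
  have hanti' : ∀ i j : Fin n, e i.succ * e j.succ + e j.succ * e i.succ =
      if i = j then (-2 : ℝ) • (1 : A) else 0 := by
    intro i j
    split_ifs with h
    · subst h
      rw [hsq _ (Fin.succ_ne_zero i), neg_smul, two_smul]; abel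
    · rw [hanti i.succ j.succ (Fin.succ_ne_zero i) (Fin.succ_ne_zero j) (by simpa using h)]
      simp
  have hvv : v * v = ∑ i : Fin n, ∑ j : Fin n, (x i.succ * x j.succ) • (e i.succ * e j.succ) := by
    rw [hv, Finset.sum_mul_sum]
    simp [smul_smul, mul_comm]
  have hvv' : v * v = ∑ i : Fin n, ∑ j : Fin n, (x i.succ * x j.succ) • (e j.succ * e i.succ) := by
    rw [hvv, Finset.sum_comm]
    simp [mul_comm]
  have h2 : (2 : ℝ) • (v * v) = (2 : ℝ) • (-(∑ i : Fin n, x i.succ ^ 2) • (1 : A)) := by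
    rw [two_smul]
    nth_rewrite 1 [hvv]
    rw [hvv', ← Finset.sum_add_distrib]
    simp only [← Finset.sum_add_distrib, ← smul_add, hanti']
    simp only [smul_ite, smul_zero, Finset.sum_ite_eq, Finset.mem_univ, if_true, smul_smul]
    rw [← Finset.sum_smul]
    congr 1
    rw [mul_neg, Finset.mul_sum, ← Finset.sum_neg_distrib]
    refine Finset.sum_congr rfl fun i _ => by ring
  have h3 : v * v = -(∑ i : Fin n, x i.succ ^ 2) • (1 : A) :=
    smul_right_injective A (two_ne_zero (α := ℝ)) h2
  have hn : ‖x‖ ^ 2 = x 0 ^ 2 + ∑ i : Fin n, x i.succ ^ 2 := by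
    rw [EuclideanSpace.real_norm_sq_eq, Fin.sum_univ_succ]
  rw [hP, hE, sub_mul, mul_add, mul_add, h3, hn]
  simp only [smul_mul_assoc, mul_smul_comm, one_mul, mul_one, smul_smul]
  rw [add_smul, neg_smul, pow_two]
  abel

/-- `embPlusE` as a continuous linear map. -/
def PLE {n : ℕ} {A : Type*} [NormedRing A] [NormedAlgebra ℝ A]
    (e : Fin (n + 1) → A) : EuclideanSpace ℝ (Fin (n + 1)) →L[ℝ] A :=
  ∑ j : Fin (n + 1), (EuclideanSpace.proj j : EuclideanSpace ℝ (Fin (n + 1)) →L[ℝ] ℝ).smulRight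
    ((if (j : ℕ) = 0 then (1 : ℝ) else -1) • e j)

theorem PLE_apply {n : ℕ} {A : Type*} [NormedRing A] [NormedAlgebra ℝ A]
    (e : Fin (n + 1) → A) (x : EuclideanSpace ℝ (Fin (n + 1))) : PLE e x = embPlusE e x := by
  simp only [PLE, embPlusE, _root_.sum_apply, ContinuousLinearMap.smulRight_apply,
    smul_smul]
  refine Finset.sum_congr rfl fun j _ => ?_
  congr 1
  split_ifs <;> simp

/-- The Cauchy kernel. -/
def KE {n : ℕ} {A : Type*} [NormedRing A] [NormedAlgebra ℝ A]
    (e : Fin (n + 1) → A) (x : EuclideanSpace ℝ (Fin (n + 1))) : A :=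
  (‖x‖ ^ (n + 1))⁻¹ • embPlusE e x

theorem KE_contDiffAt {n : ℕ} {A : Type*} [NormedRing A] [NormedAlgebra ℝ A]
    (e : Fin (n + 1) → A) {x : EuclideanSpace ℝ (Fin (n + 1))} (hx : x ≠ 0) :
    ContDiffAt ℝ 1 (KE e) x := by
  unfold KE
  simp only [← PLE_apply]
  refine ContDiffAt.smul (((contDiffAt_norm ℝ hx).pow _).inv ?_) (PLE e).contDiff.contDiffAt
  exact pow_ne_zero _ (norm_ne_zero_iff.2 hx)

theorem KE_div {n : ℕ} {A : Type*} [NormedRing A] [NormedAlgebra ℝ A]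
    (e : Fin (n + 1) → A) (he0 : e 0 = 1)
    (hsq : ∀ j : Fin (n + 1), j ≠ 0 → e j * e j = -1)
    (hanti : ∀ j k : Fin (n + 1), j ≠ 0 → k ≠ 0 → j ≠ k → e j * e k = -(e k * e j))
    {x : EuclideanSpace ℝ (Fin (n + 1))} (hx : x ≠ 0) :
    ∑ j, fderiv ℝ (KE e) x (EuclideanSpace.single j 1) * e j = 0 := by
  have hx' : ‖x‖ ≠ 0 := norm_ne_zero_iff.2 hx
  have h1 : HasDerivAt (fun r : ℝ => (r ^ (n + 1))⁻¹)
      (-((n + 1 : ℕ) * ‖x‖ ^ n) / (‖x‖ ^ (n + 1)) ^ 2) ‖x‖ := by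
    have := (hasDerivAt_pow (n + 1) ‖x‖).fun_inv (pow_ne_zero _ hx')
    simpa using this
  have h2 := (h1.comp_hasFDerivAt x (hasFDerivAt_normE hx)).fun_smul (PLE e).hasFDerivAt
  have e1 : KE e = fun y => ((fun r : ℝ => (r ^ (n + 1))⁻¹) ∘ fun y => ‖y‖) y • PLE e y := by
    funext y; simp [KE, PLE_apply]
  rw [e1, h2.fderiv]
  have pj : ∀ j, PLE e (EuclideanSpace.single j 1) * e j = 1 := by
    intro j
    rw [PLE_apply]
    have : embPlusE e (EuclideanSpace.single j (1:ℝ)) = (if (j : ℕ) = 0 then (1 : ℝ) else -1) • e j := by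
      unfold embPlusE
      rw [Finset.sum_eq_single j]
      · simp
      · intro b _ hb; simp [hb]
      · simp
    rw [this]
    by_cases hj : j = 0
    · subst hj; simp [he0]
    · have : (j : ℕ) ≠ 0 := fun h => hj (Fin.ext (by simpa using h))
      simp [this, hsq j hj]
  have e2 : ∀ j, (x j) • (PLE e x * e j) = PLE e x * (x j • e j) := fun j => (mul_smul_comm _ _ _).symm
  simp only [ContinuousLinearMap.add_apply, ContinuousLinearMap.smul_apply,
    ContinuousLinearMap.smulRight_apply, add_mul, smul_mul_assoc, pj, Finset.sum_add_distrib,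
    innerSL_apply_apply, EuclideanSpace.inner_single_right, Function.comp]
  simp only [smul_eq_mul, mul_smul, one_mul, conj_trivial, e2, ← Finset.smul_sum, ← Finset.mul_sum]
  have e3 : ∑ j, x j • e j = embE e x := rfl
  rw [e3, PLE_apply, cliffSq e he0 hsq hanti]
  simp only [Finset.sum_const, Finset.card_univ, Fintype.card_fin, smul_smul, ← Nat.cast_smul_eq_nsmul ℝ, ← add_smul]
  convert zero_smul ℝ (1 : A) using 2
  field_simp
  ring

theorem coreE {n : ℕ} {A : Type*} [NormedRing A] [NormedAlgebra ℝ A]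
    [CompleteSpace A]
    (e : Fin (n + 1) → A) (he0 : e 0 = 1)
    (hsq : ∀ j : Fin (n + 1), j ≠ 0 → e j * e j = -1)
    (hanti : ∀ j k : Fin (n + 1), j ≠ 0 → k ≠ 0 → j ≠ k → e j * e k = -(e k * e j))
    (X₀ Y₀ : EuclideanSpace ℝ (Fin (n + 1))) (R' : ℝ) (hR' : 0 < R')
    (f : EuclideanSpace ℝ (Fin (n + 1)) → A)
    (V : Set (EuclideanSpace ℝ (Fin (n + 1)))) (hV : IsOpen V)
    (hball : Metric.ball X₀ R' ⊆ V)
    (hf : ContDiffOn ℝ 1 f V)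
    (hmono : ∀ X ∈ V, diracPlusE e f X = 0)
    (hY : ∀ x, 0 < ‖x‖ → ‖x‖ < R' → X₀ + x - Y₀ ≠ 0) :
    ∃ c, ∀ r ∈ Set.Ioo 0 R', r ^ n • ∫ ω : Metric.sphere (0 : EuclideanSpace ℝ (Fin (n + 1))) 1,
      KE e (X₀ + r • (ω : EuclideanSpace ℝ (Fin (n + 1))) - Y₀) *
        embE e (ω : EuclideanSpace ℝ (Fin (n + 1))) *
        f (X₀ + r • (ω : EuclideanSpace ℝ (Fin (n + 1)))) ∂(volume.toSphere) = c := by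
  have mem : ∀ x, ‖x‖ < R' → X₀ + x ∈ V := fun x hx => hball (by simpa using hx)
  have cf : ∀ x, ‖x‖ < R' → ContDiffAt ℝ 1 f (X₀ + x) := fun x hx =>
    hf.contDiffAt (hV.mem_nhds (mem x hx))
  have cf' : ∀ x, ‖x‖ < R' → ContDiffAt ℝ 1 (fun x => f (X₀ + x)) x := fun x hx =>
    (cf x hx).comp x (contDiffAt_const.add contDiffAt_id)
  have cK : ∀ x, 0 < ‖x‖ → ‖x‖ < R' → ContDiffAt ℝ 1 (fun x => KE e (X₀ + x - Y₀)) x :=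
    fun x hx hx' => ContDiffAt.comp (g := KE e) (f := fun x => X₀ + x - Y₀) x
      (KE_contDiffAt e (hY x hx hx')) ((contDiffAt_const.add contDiffAt_id).sub contDiffAt_const)
  obtain ⟨c, hc⟩ := fluxE R' hR' (fun j x => KE e (X₀ + x - Y₀) * e j * f (X₀ + x))
    (fun j x hx => ((((cK x hx.1 hx.2).mul contDiffAt_const).mul (cf' x hx.2))).contDiffWithinAt)
    (by
      intro x hx hx'
      have hK : HasFDerivAt (fun x => KE e (X₀ + x - Y₀)) (fderiv ℝ (KE e) (X₀ + x - Y₀)) x := by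
        have h1 : HasFDerivAt (fun x => X₀ + x - Y₀) (ContinuousLinearMap.id ℝ _) x :=
          ((hasFDerivAt_id x).const_add X₀).sub_const Y₀
        exact ((KE_contDiffAt e (hY x hx hx')).differentiableAt (by simp)).hasFDerivAt.comp x h1
      have hf1 : HasFDerivAt (fun x => f (X₀ + x)) (fderiv ℝ f (X₀ + x)) x := by
        have h1 : HasFDerivAt (fun x => X₀ + x) (ContinuousLinearMap.id ℝ _) x :=
          ((hasFDerivAt_id x).const_add X₀)
        exact ((cf x hx').differentiableAt (by simp)).hasFDerivAt.comp x h1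
      have hF : ∀ j, fderiv ℝ (fun x => KE e (X₀ + x - Y₀) * e j * f (X₀ + x)) x
          (EuclideanSpace.single j 1) =
          (fderiv ℝ (KE e) (X₀ + x - Y₀) (EuclideanSpace.single j 1) * e j) * f (X₀ + x) +
          KE e (X₀ + x - Y₀) * (e j * pdE f j (X₀ + x)) := by
        intro j
        rw [((hK.mul_const' (e j)).fun_mul' hf1).fderiv]
        simp [pdE, mul_assoc, add_comm]
      simp only [hF]
      rw [Finset.sum_add_distrib, ← Finset.sum_mul, ← Finset.mul_sum,
        KE_div e he0 hsq hanti (hY x hx hx')]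
      have := hmono _ (mem x hx')
      unfold diracPlusE at this
      rw [this]; simp)
  refine ⟨c, fun r hr => ?_⟩
  rw [← hc r hr]
  congr 2
  ext ω
  rw [embE, Finset.mul_sum, Finset.sum_mul]
  simp

theorem limE {A : Type*} [NormedAddCommGroup A] (R' : ℝ) (hR' : 0 < R') (m : ℝ → A) (c : A)
    (hm : ContinuousOn m (Set.Ico 0 R')) (h : ∀ r ∈ Set.Ioo 0 R', m r = c) : m 0 = c := by
  have h1 : Filter.Tendsto m (nhdsWithin 0 (Set.Ioo 0 R')) (nhds (m 0)) :=
    (hm 0 ⟨le_rfl, hR'⟩).mono_left (nhdsWithin_mono _ Set.Ioo_subset_Ico_self)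
  have h2 : Filter.Tendsto m (nhdsWithin 0 (Set.Ioo 0 R')) (nhds c) :=
    tendsto_const_nhds.congr' (by
      filter_upwards [self_mem_nhdsWithin] with r hr using (h r hr).symm)
  have : (nhdsWithin (0:ℝ) (Set.Ioo 0 R')).NeBot := by
    rw [nhdsWithin_Ioo_eq_nhdsGT hR']; infer_instance
  exact tendsto_nhds_unique h1 h2

theorem sphere_real_univ (n : ℕ) :
    (volume : Measure (EuclideanSpace ℝ (Fin (n + 1)))).toSphere.real Set.univ = omegaN n := by
  rw [Measure.toSphere_real_apply_univ, measureReal_def, EuclideanSpace.volume_ball, omegaN]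
  have h0 : (0:ℝ) < ((n:ℝ) + 1) / 2 := by positivity
  have hG := Real.Gamma_pos_of_pos h0
  have hpi : √Real.pi ^ (n + 1) = Real.pi ^ (((n : ℝ) + 1) / 2) := by
    rw [Real.sqrt_eq_rpow, ← Real.rpow_natCast, ← Real.rpow_mul Real.pi_pos.le]
    push_cast; ring_nf
  simp only [Fintype.card_fin, finrank_euclideanSpace]
  push_cast
  rw [Real.Gamma_add_one h0.ne', hpi]
  simp only [ENNReal.ofReal_one, one_pow, one_mul]
  rw [ENNReal.toReal_ofReal (by positivity)]
  field_simp

/-- the classical Cauchy integral formula for left-monogenic functions in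
the positive definite case: for `f` left-monogenic (i.e. `∇⁺_{n,0} f = 0`) and C¹ on a
neighborhood of the closed ball of radius `R` about `X₀`,
`∫_{S_R(X₀)} ((X-X₀)⁺/‖X-X₀‖^{n+1}) ((X-X₀)/R) f(X) dS = ω_n f(X₀)`, and the analogous
integral with kernel centered at a point `Y₀` with `‖Y₀ - X₀‖ > R` vanishes. -/
theorem cauchy_formula_definite_left {A : Type*} [NormedRing A] [NormedAlgebra ℝ A]
    [CompleteSpace A]
    (n : ℕ) (hn : 2 ≤ n)
    (e : Fin (n + 1) → A) (he0 : e 0 = 1)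
    (hsq : ∀ j : Fin (n + 1), j ≠ 0 → e j * e j = -1)
    (hanti : ∀ j k : Fin (n + 1), j ≠ 0 → k ≠ 0 → j ≠ k → e j * e k = -(e k * e j))
    (X₀ : EuclideanSpace ℝ (Fin (n + 1))) (R : ℝ) (hR : 0 < R)
    (f : EuclideanSpace ℝ (Fin (n + 1)) → A)
    (V : Set (EuclideanSpace ℝ (Fin (n + 1)))) (hV : IsOpen V)
    (hball : Metric.closedBall X₀ R ⊆ V)
    (hf : ContDiffOn ℝ 1 f V)
    (hmono : ∀ X ∈ V, diracPlusE e f X = 0) :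
    sphereIntegral R X₀ (fun X =>
        ((‖X - X₀‖ ^ (n + 1))⁻¹ • embPlusE e (X - X₀)) * (R⁻¹ • embE e (X - X₀)) * f X)
      = omegaN n • f X₀ ∧
    ∀ Y₀ : EuclideanSpace ℝ (Fin (n + 1)), R < ‖Y₀ - X₀‖ →
      sphereIntegral R X₀ (fun X =>
        ((‖X - Y₀‖ ^ (n + 1))⁻¹ • embPlusE e (X - Y₀)) * (R⁻¹ • embE e (X - X₀)) * f X)
      = 0 := by
  obtain ⟨δ, hδ, hsub⟩ := (isCompact_closedBall X₀ R).exists_thickening_subset_open hV hball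
  rw [thickening_closedBall hδ hR.le] at hsub
  have sph : ∀ ω : Metric.sphere (0 : EuclideanSpace ℝ (Fin (n + 1))) 1,
      ‖(ω : EuclideanSpace ℝ (Fin (n + 1)))‖ = 1 := by
    intro ω; simp
  have mem : ∀ x, ‖x‖ < δ + R → X₀ + x ∈ V := fun x hx => hsub (by simpa using hx)
  have hcont : ∀ R', R' ≤ δ + R → ContinuousOn (fun p : ℝ × Metric.sphere (0 : EuclideanSpace ℝ (Fin (n + 1))) 1 =>
      f (X₀ + p.1 • (p.2 : EuclideanSpace ℝ (Fin (n + 1))))) (Set.Ico 0 R' ×ˢ Set.univ) := by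
    intro R' hR'
    refine hf.continuousOn.comp (by fun_prop) ?_
    rintro ⟨r, ω⟩ ⟨hr, -⟩
    apply mem
    rw [norm_smul, sph, mul_one, Real.norm_eq_abs, abs_of_nonneg hr.1]
    exact hr.2.trans_le hR'
  have embs : ∀ (r : ℝ) x, embE e (r • x) = r • embE e x := fun r x => by
    simp [embE, Finset.smul_sum, smul_smul]
  have hsi : ∀ Y₀, sphereIntegral R X₀ (fun X =>
        ((‖X - Y₀‖ ^ (n + 1))⁻¹ • embPlusE e (X - Y₀)) * (R⁻¹ • embE e (X - X₀)) * f X) =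
      R ^ n • ∫ ω : Metric.sphere (0 : EuclideanSpace ℝ (Fin (n + 1))) 1,
      KE e (X₀ + R • (ω : EuclideanSpace ℝ (Fin (n + 1))) - Y₀) *
        embE e (ω : EuclideanSpace ℝ (Fin (n + 1))) *
        f (X₀ + R • (ω : EuclideanSpace ℝ (Fin (n + 1)))) ∂(volume.toSphere) := by
    intro Y₀
    unfold sphereIntegral KE
    congr 2
    ext ω
    simp only
    rw [add_sub_cancel_left, embs, smul_smul, inv_mul_cancel₀ hR.ne', one_smul]
  constructor
  · rw [hsi]
    obtain ⟨c, hc⟩ := coreE e he0 hsq hanti X₀ X₀ (δ + R) (by linarith) f V hV hsub hf hmono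
      (by intro x hx _; simpa using hx)
    rw [hc R ⟨hR, by linarith⟩]
    symm
    have key := limE (δ + R) (by linarith)
      (fun r => ∫ ω : Metric.sphere (0 : EuclideanSpace ℝ (Fin (n + 1))) 1,
        f (X₀ + r • (ω : EuclideanSpace ℝ (Fin (n + 1)))) ∂(volume.toSphere)) c
      (continuousOn_integral_of_compact_support isCompact_univ (hcont _ le_rfl) (by simp))
      (by
        intro r hr
        rw [← hc r hr, ← integral_smul]
        congr 1
        ext ω
        have hr0 : r ≠ 0 := hr.1.ne'
        have e1 : embPlusE e (r • (ω : EuclideanSpace ℝ (Fin (n + 1)))) =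
            r • embPlusE e (ω : EuclideanSpace ℝ (Fin (n + 1))) := by
          rw [← PLE_apply, ← PLE_apply, map_smul]
        rw [add_sub_cancel_left, KE, e1, norm_smul, sph, Real.norm_eq_abs, abs_of_pos hr.1]
        simp only [smul_smul, smul_mul_assoc, cliffSq e he0 hsq hanti, one_mul, sph]
        have : r ^ n * (((r * 1) ^ (n + 1))⁻¹ * r * 1 ^ 2) = 1 := by
          rw [mul_one, one_pow, mul_one, pow_succ]
          field_simp
        rw [this, one_smul])
    rw [← key]
    simp only [zero_smul, add_zero]
    rw [integral_const, sphere_real_univ]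
  · intro Y₀ hY₀
    rw [hsi]
    set R' := min (δ + R) ‖Y₀ - X₀‖ with hR'
    have h1 : R < R' := lt_min (by linarith) hY₀
    have hne : ∀ x, ‖x‖ < R' → X₀ + x - Y₀ ≠ 0 := by
      intro x hx h
      have : x = Y₀ - X₀ := by rw [sub_eq_zero] at h; rw [← h]; simp
      rw [this] at hx
      exact absurd (min_le_right (δ + R) ‖Y₀ - X₀‖) (not_le.2 hx)
    obtain ⟨c, hc⟩ := coreE e he0 hsq hanti X₀ Y₀ R' (by linarith) f V hV
      ((Metric.ball_subset_ball (min_le_left _ _)).trans hsub) hf hmono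
      (fun x _ hx => hne x hx)
    rw [hc R ⟨hR, h1⟩]
    have key := limE R' (by linarith) _ c ?_ hc
    · rw [← key, zero_pow (by omega), zero_smul]
    · refine ContinuousOn.smul (by fun_prop) ?_
      refine continuousOn_integral_of_compact_support isCompact_univ ?_ (by simp)
      refine ContinuousOn.mul (ContinuousOn.mul ?_ ?_) (hcont _ (min_le_left _ _))
      · intro p hp
        refine ContinuousAt.continuousWithinAt ?_
        refine ContinuousAt.comp (g := KE e) (f := fun p : ℝ × Metric.sphere (0 : EuclideanSpace ℝ (Fin (n + 1))) 1 => X₀ + p.1 • (p.2 : EuclideanSpace ℝ (Fin (n + 1))) - Y₀)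
          (KE_contDiffAt e (hne _ ?_)).continuousAt (by fun_prop)
        rw [norm_smul, sph, mul_one, Real.norm_eq_abs, abs_of_nonneg hp.1.1]
        exact hp.1.2
      · unfold embE
        fun_prop

end
end

section
/- Let p, q ≥ 0 with p+q ≥ 2 and ε > 0. On ℝ^{p+q+1} ∖ {0}, the modified Green's function G_{p,q,ε}(X) = (N(X)+iε‖X‖²)^{−(p+q+1)/2} X⁺ satisfies ∇⁺_{p,q} G_{p,q,ε}(X) = iε(p+q+1) (‖X‖² e_0 − X̄ X⁺) (N(X)+iε‖X‖²)^{−(p+q+3)/2} and G_{p,q,ε} ∇⁺_{p,q}(X) = iε(p+q+1) (‖X‖² e_0 − X⁺ X̄) (N(X)+iε‖X‖²)^{−(p+q+3)/2}. -/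
open scoped BigOperators

noncomputable section

/-- `N(X) = ∑_{j=0}^p x_j² - ∑_{j=p+1}^{p+q} x̃_j²`. -/
def Npq (p q : ℕ) (X : Fin (p + q + 1) → ℝ) : ℝ :=
  ∑ j : Fin (p + q + 1), if (j : ℕ) ≤ p then X j ^ 2 else -(X j ^ 2)

/-- `‖X‖² = ∑_j x_j²`. -/
def nsq {m : ℕ} (X : Fin m → ℝ) : ℝ := ∑ j, X j ^ 2

/-- The Clifford conjugate `X⁺ = x_0 e_0 - ∑ x_j e_j - ∑ x̃_j ẽ_j`. -/
def embP {m : ℕ} {A : Type*} [NormedRing A] [NormedAlgebra ℝ A]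
    (e : Fin m → A) (X : Fin m → ℝ) : A :=
  ∑ j : Fin m, (if (j : ℕ) = 0 then X j else -X j) • e j

/-- The complex conjugate `X̄ = x_0 e_0 + ∑ x_j e_j - ∑ x̃_j ẽ_j`. -/
def embBar (p : ℕ) {m : ℕ} {A : Type*} [NormedRing A] [NormedAlgebra ℝ A]
    (e : Fin m → A) (X : Fin m → ℝ) : A :=
  ∑ j : Fin m, (if (j : ℕ) ≤ p then X j else -X j) • e j

/-- `N(X) + iε‖X‖²`. -/
def wfun (p q : ℕ) (ε : ℝ) (X : Fin (p + q + 1) → ℝ) : ℂ :=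
  ((Npq p q X : ℝ) : ℂ) + (ε : ℂ) * Complex.I * ((nsq X : ℝ) : ℂ)

/-- The square root `(N(X) + iε‖X‖²)^{1/2}` with positive real part
(the principal branch, via `Complex.cpow`). -/
def sqw (p q : ℕ) (ε : ℝ) (X : Fin (p + q + 1) → ℝ) : ℂ :=
  wfun p q ε X ^ ((1 : ℂ) / 2)

/-- The modified Green's function
`G_{p,q,ε}(X) = (N(X) + iε‖X‖²)^{-(p+q+1)/2} X⁺`, with values in `ℂ ⊗_ℝ 𝒜_{p,q}`. -/
def Geps (p q : ℕ) {A : Type*} [NormedRing A] [NormedAlgebra ℝ A] [NormedAlgebra ℂ A]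
    (e : Fin (p + q + 1) → A) (ε : ℝ) (X : Fin (p + q + 1) → ℝ) : A :=
  (sqw p q ε X ^ (-((p : ℤ) + (q : ℤ) + 1))) • embP e X

/-- The `j`-th partial derivative. -/
def pdR {m : ℕ} {A : Type*} [NormedAddCommGroup A] [NormedSpace ℝ A]
    (f : (Fin m → ℝ) → A) (j : Fin m) (X : Fin m → ℝ) : A :=
  fderiv ℝ f X (Pi.single j 1)

/-- Sign for `∇⁺_{p,q}`. -/
def sgnP (p : ℕ) {m : ℕ} (j : Fin m) : ℝ := if (j : ℕ) ≤ p then 1 else -1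

/-- The left Dirac operator `∇⁺_{p,q} f`. -/
def diracPlusL (p q : ℕ) {A : Type*} [NormedRing A] [NormedAlgebra ℝ A]
    (e : Fin (p + q + 1) → A) (f : (Fin (p + q + 1) → ℝ) → A)
    (X : Fin (p + q + 1) → ℝ) : A :=
  ∑ j, sgnP p j • (e j * pdR f j X)

/-- The right Dirac operator `f ∇⁺_{p,q}`. -/
def diracPlusR (p q : ℕ) {A : Type*} [NormedRing A] [NormedAlgebra ℝ A]
    (e : Fin (p + q + 1) → A) (f : (Fin (p + q + 1) → ℝ) → A)
    (X : Fin (p + q + 1) → ℝ) : A :=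
  ∑ j, sgnP p j • (pdR f j X * e j)

/-- The embedding of `X` itself. -/
def embX {m : ℕ} {A : Type*} [NormedRing A] [NormedAlgebra ℝ A]
    (e : Fin m → A) (X : Fin m → ℝ) : A :=
  ∑ j : Fin m, X j • e j

/-- Sign of the Clifford conjugation. -/
def cgn {m : ℕ} (j : Fin m) : ℝ := if (j : ℕ) = 0 then 1 else -1

lemma embP_eq {m : ℕ} {A : Type*} [NormedRing A] [NormedAlgebra ℝ A]
    (e : Fin m → A) (X : Fin m → ℝ) : embP e X = ∑ j, (cgn j * X j) • e j := by
  unfold embP cgn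
  refine Finset.sum_congr rfl fun j _ => ?_
  split_ifs <;> simp

lemma embBar_eq (p : ℕ) {m : ℕ} {A : Type*} [NormedRing A] [NormedAlgebra ℝ A]
    (e : Fin m → A) (X : Fin m → ℝ) : embBar p e X = ∑ j, (sgnP p j * X j) • e j := by
  unfold embBar sgnP
  refine Finset.sum_congr rfl fun j _ => ?_
  split_ifs <;> simp

lemma Npq_eq (p q : ℕ) (X : Fin (p + q + 1) → ℝ) :
    Npq p q X = ∑ j, sgnP p j * X j ^ 2 := by
  unfold Npq sgnP
  refine Finset.sum_congr rfl fun j _ => ?_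
  split_ifs <;> simp

lemma wfun_eq (p q : ℕ) (ε : ℝ) (X : Fin (p + q + 1) → ℝ) :
    wfun p q ε X = ∑ j, ((sgnP p j : ℂ) + ε * Complex.I) * ((X j : ℝ) : ℂ) ^ 2 := by
  unfold wfun nsq
  rw [Npq_eq]
  push_cast
  rw [Finset.mul_sum, ← Finset.sum_add_distrib]
  refine Finset.sum_congr rfl fun j _ => ?_
  ring

lemma nsq_pos {m : ℕ} (X : Fin m → ℝ) (hX : X ≠ 0) : 0 < nsq X := by
  obtain ⟨j, hj⟩ := Function.ne_iff.mp hX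
  exact Finset.sum_pos' (fun i _ => sq_nonneg _) ⟨j, Finset.mem_univ _, by
    have : X j ≠ 0 := hj
    positivity⟩

lemma wfun_slit (p q : ℕ) (ε : ℝ) (hε : 0 < ε) (X : Fin (p + q + 1) → ℝ) (hX : X ≠ 0) :
    wfun p q ε X ∈ Complex.slitPlane := by
  right
  have h := nsq_pos X hX
  have : (wfun p q ε X).im = ε * nsq X := by simp [wfun]
  rw [this]
  positivity

lemma hasFDerivAt_wfun (p q : ℕ) (ε : ℝ) (X : Fin (p + q + 1) → ℝ) :
    ∃ L : (Fin (p + q + 1) → ℝ) →L[ℝ] ℂ, HasFDerivAt (wfun p q ε) L X ∧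
      ∀ j, L (Pi.single j 1) = 2 * ((sgnP p j : ℂ) + ε * Complex.I) * X j := by
  have h : ∀ j ∈ (Finset.univ : Finset (Fin (p + q + 1))),
      HasFDerivAt (fun Y : Fin (p + q + 1) → ℝ =>
        ((sgnP p j : ℂ) + ε * Complex.I) * ((Y j : ℝ) : ℂ) ^ 2)
        ((2 * ((sgnP p j : ℂ) + ε * Complex.I) * X j) •
          (Complex.ofRealCLM.comp (ContinuousLinearMap.proj (R := ℝ) j))) X := by
    intro j _
    have h1 : HasFDerivAt (fun Y : Fin (p + q + 1) → ℝ => ((Y j : ℝ) : ℂ))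
        (Complex.ofRealCLM.comp (ContinuousLinearMap.proj (R := ℝ) j)) X :=
      (Complex.ofRealCLM.comp (ContinuousLinearMap.proj (R := ℝ) (φ := fun _ => ℝ) j)).hasFDerivAt
    have h2 := (h1.pow 2).const_mul ((sgnP p j : ℂ) + ε * Complex.I)
    refine h2.congr_fderiv ?_
    ext v
    simp
    ring
  have h3 := HasFDerivAt.fun_sum h
  refine ⟨∑ j, ((2 * ((sgnP p j : ℂ) + ε * Complex.I) * X j) •
          (Complex.ofRealCLM.comp (ContinuousLinearMap.proj (R := ℝ) j))), ?_, ?_⟩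
  · have : wfun p q ε = fun Y => ∑ j, ((sgnP p j : ℂ) + ε * Complex.I) * ((Y j : ℝ) : ℂ) ^ 2 :=
      funext (wfun_eq p q ε)
    rw [this]
    exact h3
  · intro j
    simp only [_root_.sum_apply, _root_.smul_apply, ContinuousLinearMap.comp_apply,
      ContinuousLinearMap.proj_apply, Pi.single_apply]
    rw [Finset.sum_eq_single j]
    · simp
    · intro b _ hb; simp [hb]
    · simp

lemma hasDerivAt_half (w : ℂ) (hw : w ∈ Complex.slitPlane) (k : ℤ) :
    HasDerivAt (fun z : ℂ => (z ^ ((1 : ℂ) / 2)) ^ k)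
      ((k : ℂ) / 2 * (w ^ ((1 : ℂ) / 2)) ^ (k - 2)) w := by
  have hw0 : w ≠ 0 := Complex.slitPlane_ne_zero hw
  have hs0 : w ^ ((1 : ℂ) / 2) ≠ 0 := by
    rw [Complex.cpow_ne_zero_iff]; exact Or.inl hw0
  have h1 : HasDerivAt (fun z : ℂ => z ^ ((1 : ℂ) / 2)) _ w :=
    (hasDerivAt_id w).cpow_const hw
  have h2 := (hasDerivAt_zpow k (w ^ ((1 : ℂ) / 2)) (Or.inl hs0)).comp w h1
  refine h2.congr_deriv ?_
  have h3 : w ^ ((1 : ℂ) / 2 - 1) = (w ^ ((1 : ℂ) / 2))⁻¹ := by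
    rw [← Complex.cpow_neg]; norm_num
  have h4 : (w ^ ((1 : ℂ) / 2)) ^ (k - 2) =
      (w ^ ((1 : ℂ) / 2)) ^ (k - 1) * (w ^ ((1 : ℂ) / 2))⁻¹ := by
    rw [← zpow_sub_one₀ hs0]; congr 1; ring
  simp only [id, h3, h4]
  ring

lemma sqw_sq (p q : ℕ) (ε : ℝ) (X : Fin (p + q + 1) → ℝ) :
    sqw p q ε X ^ 2 = wfun p q ε X := by
  unfold sqw
  simp

lemma real_smul_eq {A : Type*} [NormedRing A] [NormedAlgebra ℝ A]
    [NormedAlgebra ℂ A] [IsScalarTower ℝ ℂ A] (r : ℝ) (a : A) :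
    @HSMul.hSMul ℝ A A (@instHSMul ℝ A Algebra.toSMul) r a = (r : ℂ) • a := by
  have h := smul_assoc r (1 : ℂ) a
  rw [one_smul, Complex.real_smul, mul_one] at h
  exact h.symm

lemma hasFDerivAt_embP {A : Type*} [NormedRing A] [NormedAlgebra ℝ A] {m : ℕ}
    (e : Fin m → A) (X : Fin m → ℝ) :
    ∃ L : (Fin m → ℝ) →L[ℝ] A, HasFDerivAt (fun Y : Fin m → ℝ => embP e Y) L X ∧
      ∀ j, L (Pi.single j 1) = cgn j • e j := by
  refine ⟨∑ j, (cgn j • (ContinuousLinearMap.proj (R := ℝ)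
      (φ := fun _ : Fin m => ℝ) j)).smulRight (e j), ?_, ?_⟩
  · have : (fun Y : Fin m → ℝ => embP e Y) =
      ⇑(∑ j, (cgn j • (ContinuousLinearMap.proj (R := ℝ)
        (φ := fun _ : Fin m => ℝ) j)).smulRight (e j)) := by
      funext Y
      simp [embP_eq, _root_.sum_apply]
    rw [this]
    exact ContinuousLinearMap.hasFDerivAt _
  · intro j
    simp only [_root_.sum_apply, ContinuousLinearMap.smulRight_apply,
      _root_.smul_apply, ContinuousLinearMap.proj_apply, Pi.single_apply]
    rw [Finset.sum_eq_single j]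
    · rw [if_pos rfl, smul_eq_mul, mul_one]
    · intro b _ hb; simp [hb]
    · simp

lemma fderiv_smul_apply {𝕜 : Type*} [NontriviallyNormedField 𝕜] {E : Type*}
    [NormedAddCommGroup E] [NormedSpace 𝕜 E] {F : Type*} [NormedAddCommGroup F]
    [NormedSpace 𝕜 F] {f : E → F} {f' : E →L[𝕜] F} {x : E} {𝕜' : Type*} [NormedRing 𝕜']
    [NormedAlgebra 𝕜 𝕜'] [Module 𝕜' F] [IsBoundedSMul 𝕜' F] [IsScalarTower 𝕜 𝕜' F]
    {c : E → 𝕜'} {c' : E →L[𝕜] 𝕜'} (hc : HasFDerivAt c c' x) (hf : HasFDerivAt f f' x) (v : E) :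
    fderiv 𝕜 (fun i => c i • f i) x v = c x • f' v + c' v • f x := by
  rw [(hc.fun_smul hf).fderiv]
  rfl

lemma pdR_Geps {A : Type*} [NormedRing A] [NormedAlgebra ℝ A]
    [NormedAlgebra ℂ A] [IsScalarTower ℝ ℂ A]
    (p q : ℕ) (ε : ℝ) (hε : 0 < ε) (e : Fin (p + q + 1) → A)
    (X : Fin (p + q + 1) → ℝ) (hX : X ≠ 0) (j : Fin (p + q + 1)) :
    @pdR _ A _ (NormedAlgebra.toNormedSpace A) (Geps p q e ε) j X =
      (sqw p q ε X ^ (-((p : ℤ) + (q : ℤ) + 1))) • ((cgn j : ℂ) • e j) +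
      (-((p : ℂ) + q + 1) * sqw p q ε X ^ (-((p : ℤ) + (q : ℤ) + 3)) *
        (((sgnP p j : ℂ) + ε * Complex.I) * X j)) • embP e X := by
  obtain ⟨L, hL, hLj⟩ := hasFDerivAt_wfun p q ε X
  have h1 := (hasDerivAt_half _ (wfun_slit p q ε hε X hX)
    (-((p : ℤ) + (q : ℤ) + 1))).comp_hasFDerivAt X hL
  obtain ⟨L2, h2, hL2⟩ := hasFDerivAt_embP e X
  have h3 := @fderiv_smul_apply ℝ _ _ _ _ A _ (NormedAlgebra.toNormedSpace A)
    _ _ _ ℂ _ _ _ _ _ _ _ h1 h2 (Pi.single j 1)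
  refine h3.trans ?_
  have h5 : L2 (Pi.single j 1) = (cgn j : ℂ) • e j := by
    rw [hL2, real_smul_eq]
  have hexp : -((p : ℤ) + (q : ℤ) + 1) - 2 = -((p : ℤ) + (q : ℤ) + 3) := by ring
  rw [h5, _root_.smul_apply, hLj, hexp]
  congr 2
  simp only [sqw, smul_eq_mul]
  push_cast
  ring

lemma sgn_cgn_sq {A : Type*} [NormedRing A] [NormedAlgebra ℝ A]
    (p q : ℕ) (e : Fin (p + q + 1) → A) (he0 : e 0 = 1)
    (hsqNeg : ∀ j : Fin (p + q + 1), 1 ≤ (j : ℕ) → (j : ℕ) ≤ p → e j * e j = -1)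
    (hsqPos : ∀ j : Fin (p + q + 1), p < (j : ℕ) → e j * e j = 1) (j : Fin (p + q + 1)) :
    e j * e j = (sgnP p j * cgn j) • (1 : A) := by
  unfold sgnP cgn
  by_cases h0 : (j : ℕ) = 0
  · have : j = 0 := Fin.ext h0
    subst this
    simp [he0]
  · by_cases hp : (j : ℕ) ≤ p
    · rw [hsqNeg j (by omega) hp]; simp [h0, hp]
    · rw [hsqPos j (by omega)]; simp [h0, hp]

lemma sgnP_sq (p : ℕ) {m : ℕ} (j : Fin m) : sgnP p j * sgnP p j = 1 := by
  unfold sgnP; split_ifs <;> simp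

lemma cgn_sq {m : ℕ} (j : Fin m) : cgn j * cgn j = 1 := by
  unfold cgn; split_ifs <;> simp

/-- Off-diagonal terms are antisymmetric. -/
lemma offdiag {A : Type*} [NormedRing A] [NormedAlgebra ℝ A]
    (p q : ℕ) (e : Fin (p + q + 1) → A) (he0 : e 0 = 1)
    (hanti : ∀ j k : Fin (p + q + 1), j ≠ 0 → k ≠ 0 → j ≠ k → e j * e k = -(e k * e j))
    (j k : Fin (p + q + 1)) (hjk : j ≠ k) :
    cgn k • (e j * e k) + cgn j • (e k * e j) = 0 := by
  by_cases hj : j = 0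
  · subst hj
    have hk : (k : ℕ) ≠ 0 := fun h => hjk (Fin.ext h).symm
    simp [cgn, hk, he0]
  · by_cases hk : k = 0
    · subst hk
      have hj' : (j : ℕ) ≠ 0 := fun h => hj (Fin.ext h)
      simp [cgn, hj', he0]
    · have hj' : (j : ℕ) ≠ 0 := fun h => hj (Fin.ext h)
      have hk' : (k : ℕ) ≠ 0 := fun h => hk (Fin.ext h)
      rw [hanti j k hj hk hjk]
      simp [cgn, hj', hk']

lemma sum_sym {A : Type*} [NormedRing A] [NormedAlgebra ℝ A] {m : ℕ} (F : Fin m → Fin m → A)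
    (D : Fin m → A) (hD : ∀ j, F j j = D j) (hF : ∀ j k, j ≠ k → F j k + F k j = 0) :
    ∑ j, ∑ k, F j k = ∑ j, D j := by
  have h2 : (2 : ℝ) • (∑ j, ∑ k, F j k) = (2 : ℝ) • ∑ j, D j := by
    rw [two_smul, two_smul]
    nth_rewrite 2 [Finset.sum_comm]
    rw [← Finset.sum_add_distrib, ← Finset.sum_add_distrib]
    refine Finset.sum_congr rfl fun j _ => ?_
    rw [← Finset.sum_add_distrib, Finset.sum_eq_single j]
    · rw [hD]
    · intro k _ hk; exact hF j k (Ne.symm hk)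
    · simp
  exact smul_right_injective A (two_ne_zero (α := ℝ)) h2

lemma XP {A : Type*} [NormedRing A] [NormedAlgebra ℝ A]
    (p q : ℕ) (e : Fin (p + q + 1) → A) (he0 : e 0 = 1)
    (hsqNeg : ∀ j : Fin (p + q + 1), 1 ≤ (j : ℕ) → (j : ℕ) ≤ p → e j * e j = -1)
    (hsqPos : ∀ j : Fin (p + q + 1), p < (j : ℕ) → e j * e j = 1)
    (hanti : ∀ j k : Fin (p + q + 1), j ≠ 0 → k ≠ 0 → j ≠ k → e j * e k = -(e k * e j))
    (X : Fin (p + q + 1) → ℝ) :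
    embX e X * embP e X = Npq p q X • (1 : A) ∧ embP e X * embX e X = Npq p q X • (1 : A) := by
  have hd := sgn_cgn_sq p q e he0 hsqNeg hsqPos
  have ho := offdiag p q e he0 hanti
  rw [embP_eq, embX, Npq_eq, Finset.sum_mul_sum, Finset.sum_mul_sum, Finset.sum_smul]
  constructor
  · apply sum_sym
    · intro j
      rw [smul_mul_smul_comm, hd, smul_smul]
      congr 1
      linear_combination (X j ^ 2 * sgnP p j) * cgn_sq j
    · intro j k hjk
      have := congrArg (fun a => (X j * X k) • a) (ho j k hjk)
      simp only [smul_add, smul_zero, smul_smul] at this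
      rw [smul_mul_smul_comm, smul_mul_smul_comm, ← this]
      congr 2 <;> ring
  · apply sum_sym
    · intro j
      rw [smul_mul_smul_comm, hd, smul_smul]
      congr 1
      linear_combination (X j ^ 2 * sgnP p j) * cgn_sq j
    · intro j k hjk
      have := congrArg (fun a => (X j * X k) • a) (ho k j hjk.symm)
      simp only [smul_add, smul_zero, smul_smul] at this
      rw [smul_mul_smul_comm, smul_mul_smul_comm, ← this, add_comm]
      rw [add_comm]
      have h' : cgn j • (e j * e k) + cgn k • (e k * e j) = 0 := by
        have h0 := congrArg (fun a => (cgn j * cgn k) • a) (ho j k hjk)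
        simp only [smul_add, smul_zero, smul_smul] at h0
        rw [← h0]
        congr 2
        · linear_combination (-cgn j) * cgn_sq k
        · linear_combination (-cgn k) * cgn_sq j
      have h0 := congrArg (fun a => (X j * X k) • a) h'
      simp only [smul_add, smul_zero, smul_smul] at h0
      rw [this, ← h0]
      congr 2 <;> ring

/-- The final algebraic step. -/
lemma final_alg {A : Type*} [NormedRing A] [NormedAlgebra ℂ A] (n N ε M s1 s3 w : ℂ) (B : A)
    (hw : w = N + ε * Complex.I * M) (hs : s1 = s3 * w) :
    (n * s1) • (1 : A) + (-n * s3) • (N • (1 : A) + (ε * Complex.I) • B) =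
      (Complex.I * ε * n * s3) • (M • (1 : A) - B) := by
  subst hs hw
  module

/-- for `ε > 0` and `X ≠ 0`,
`∇⁺_{p,q} G_{p,q,ε}(X) = iε(p+q+1)(‖X‖² e_0 - X̄X⁺)(N(X)+iε‖X‖²)^{-(p+q+3)/2}` and
`G_{p,q,ε}∇⁺_{p,q}(X) = iε(p+q+1)(‖X‖² e_0 - X⁺X̄)(N(X)+iε‖X‖²)^{-(p+q+3)/2}`. -/
theorem dirac_of_modified_green {A : Type*} [NormedRing A] [NormedAlgebra ℝ A]
    [NormedAlgebra ℂ A] [IsScalarTower ℝ ℂ A]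
    (p q : ℕ) (hpq : 2 ≤ p + q) (ε : ℝ) (hε : 0 < ε)
    (e : Fin (p + q + 1) → A) (he0 : e 0 = 1)
    (hsqNeg : ∀ j : Fin (p + q + 1), 1 ≤ (j : ℕ) → (j : ℕ) ≤ p → e j * e j = -1)
    (hsqPos : ∀ j : Fin (p + q + 1), p < (j : ℕ) → e j * e j = 1)
    (hanti : ∀ j k : Fin (p + q + 1), j ≠ 0 → k ≠ 0 → j ≠ k → e j * e k = -(e k * e j)) :
    ∀ X : Fin (p + q + 1) → ℝ, X ≠ 0 →
      diracPlusL p q e (Geps p q e ε) X =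
        (Complex.I * (ε : ℂ) * ((p : ℂ) + (q : ℂ) + 1) *
            sqw p q ε X ^ (-((p : ℤ) + (q : ℤ) + 3))) •
          (((nsq X : ℝ) : ℂ) • (1 : A) - embBar p e X * embP e X) ∧
      diracPlusR p q e (Geps p q e ε) X =
        (Complex.I * (ε : ℂ) * ((p : ℂ) + (q : ℂ) + 1) *
            sqw p q ε X ^ (-((p : ℤ) + (q : ℤ) + 3))) •
          (((nsq X : ℝ) : ℂ) • (1 : A) - embP e X * embBar p e X) := by
  intro X hX
  have hd := sgn_cgn_sq p q e he0 hsqNeg hsqPos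
  obtain ⟨hXP, hPX⟩ := XP p q e he0 hsqNeg hsqPos hanti X
  have hs0 : sqw p q ε X ≠ 0 := by
    intro h
    have h2 := sqw_sq p q ε X
    rw [h] at h2
    exact Complex.slitPlane_ne_zero (wfun_slit p q ε hε X hX) (by rw [← h2]; simp)
  have hs : sqw p q ε X ^ (-((p : ℤ) + (q : ℤ) + 1)) =
      sqw p q ε X ^ (-((p : ℤ) + (q : ℤ) + 3)) * wfun p q ε X := by
    rw [← sqw_sq, ← zpow_natCast, ← zpow_add₀ hs0]
    congr 1
  have hsum1 : ∀ c : ℂ, ∑ _j : Fin (p + q + 1), c • (1 : A) =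
      (((p : ℂ) + q + 1) * c) • (1 : A) := by
    intro c
    rw [Finset.sum_const, Finset.card_univ, Fintype.card_fin, ← Nat.cast_smul_eq_nsmul ℂ, smul_smul]
    push_cast
    rfl
  have hdC : ∀ j, e j * e j = ((sgnP p j : ℂ) * cgn j) • (1 : A) := by
    intro j
    rw [hd, real_smul_eq]
    push_cast
    rfl
  have hscC : ∀ j : Fin (p + q + 1), (sgnP p j : ℂ) * sgnP p j = 1 := fun j => by
    exact_mod_cast sgnP_sq p j
  have hccC : ∀ j : Fin (p + q + 1), (cgn j : ℂ) * cgn j = 1 := fun j => by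
    exact_mod_cast cgn_sq j
  have hvec : embX e X + ((ε : ℂ) * Complex.I) • embBar p e X =
      ∑ j, ((sgnP p j : ℂ) * (((sgnP p j : ℂ) + ε * Complex.I) * X j)) • e j := by
    rw [embX, embBar_eq, Finset.smul_sum, ← Finset.sum_add_distrib]
    refine Finset.sum_congr rfl fun j _ => ?_
    rw [real_smul_eq, real_smul_eq, smul_smul, ← add_smul]
    congr 1
    push_cast
    linear_combination (-(X j : ℂ)) * hscC j
  constructor
  · rw [← final_alg _ _ _ _ _ _ _ _ rfl hs, ← real_smul_eq (Npq p q X), ← hXP, ← smul_mul_assoc,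
      ← add_mul, hvec, ← hsum1, Finset.sum_mul, Finset.smul_sum, ← Finset.sum_add_distrib]
    unfold diracPlusL
    refine Finset.sum_congr rfl fun j _ => ?_
    rw [pdR_Geps p q ε hε e X hX j, real_smul_eq, mul_add, mul_smul_comm, mul_smul_comm, hdC,
      mul_smul_comm, smul_mul_assoc, smul_add]
    simp only [smul_smul]
    congr 2
    · linear_combination (sqw p q ε X ^ (-((p : ℤ) + (q : ℤ) + 1))) *
        ((cgn j : ℂ) * cgn j * hscC j + hccC j)
    · ring
  · rw [← final_alg _ _ _ _ _ _ _ _ rfl hs, ← real_smul_eq (Npq p q X), ← hPX, ← mul_smul_comm,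
      ← mul_add, hvec, ← hsum1, Finset.mul_sum, Finset.smul_sum, ← Finset.sum_add_distrib]
    unfold diracPlusR
    refine Finset.sum_congr rfl fun j _ => ?_
    rw [pdR_Geps p q ε hε e X hX j, real_smul_eq, add_mul, smul_mul_assoc, smul_mul_assoc, hdC,
      smul_mul_assoc, mul_smul_comm, smul_add]
    simp only [smul_smul]
    congr 2
    · linear_combination (sqw p q ε X ^ (-((p : ℤ) + (q : ℤ) + 1))) *
        ((cgn j : ℂ) * cgn j * hscC j + hccC j)
    · ring

end
end

section
/- Let p, q ≥ 1 with p+q ≥ 2. Then lim_{ε→0⁺} ∫_0^{π/2} cos^pθ sin^{q−1}θ (cos 2θ + iε)^{−(p+q+1)/2} dθ = (−i)^q · ω_{p+q} / (ω_p ω_{q−1}). In other words, C_{p,q} = (−i)^q ω_{p+q}/(ω_p ω_{q−1}). -/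
open scoped BigOperators
open Filter

noncomputable section

/-- the quadratic form `a cos² + b sin²` -/
def WW (a b : ℂ) (t : ℝ) : ℂ := a * (Real.cos t : ℂ) ^ 2 + b * (Real.sin t : ℂ) ^ 2

lemma WW_slit {a b : ℂ} (ha : 0 < a.im) (hb : 0 < b.im) (t : ℝ) :
    WW a b t ∈ Complex.slitPlane := by
  right
  have h := Real.cos_sq_add_sin_sq t
  have him : (WW a b t).im = a.im * Real.cos t ^ 2 + b.im * Real.sin t ^ 2 := by
    unfold WW
    rw [← Complex.ofReal_pow, ← Complex.ofReal_pow, Complex.add_im, Complex.im_mul_ofReal,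
      Complex.im_mul_ofReal]
  rw [him]
  rcases (sq_nonneg (Real.cos t)).eq_or_lt with h0 | h0
  · rw [← h0] at h ⊢
    have : Real.sin t ^ 2 = 1 := by linarith
    rw [this]
    linarith
  · have : 0 ≤ b.im * Real.sin t ^ 2 := by positivity
    have : 0 < a.im * Real.cos t ^ 2 := by positivity
    linarith

lemma WW_self (a : ℂ) (t : ℝ) : WW a a t = a := by
  have h : (Real.cos t : ℂ) ^ 2 + (Real.sin t : ℂ) ^ 2 = 1 := by
    exact_mod_cast Real.cos_sq_add_sin_sq t
  unfold WW
  linear_combination a * h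

lemma WW_cont (a : ℂ) : Continuous (fun x : ℂ × ℝ => WW a x.1 x.2) := by
  unfold WW
  fun_prop

/-- Differentiation under the integral sign. -/
lemma GG_deriv (a : ℂ) (ha : 0 < a.im) (p k : ℕ) (c : ℂ) (b₀ : ℂ) (hb₀ : 0 < b₀.im) :
    HasDerivAt (fun b : ℂ => ∫ t in (0 : ℝ)..(Real.pi / 2),
        (Real.cos t : ℂ) ^ p * (Real.sin t : ℂ) ^ k * WW a b t ^ c)
      (∫ t in (0 : ℝ)..(Real.pi / 2),
        (Real.cos t : ℂ) ^ p * (Real.sin t : ℂ) ^ k *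
          (c * WW a b₀ t ^ (c - 1) * (Real.sin t : ℂ) ^ 2)) b₀ := by
  have hcont : ∀ d : ℂ, ContinuousOn (fun x : ℂ × ℝ => WW a x.1 x.2 ^ d)
      {x : ℂ × ℝ | 0 < x.1.im} := by
    intro d
    apply ContinuousOn.cpow_const (WW_cont a).continuousOn
    intro x hx
    exact WW_slit ha hx _
  have hcont1 : ∀ d b : ℂ, 0 < b.im → Continuous (fun t : ℝ => WW a b t ^ d) := by
    intro d b hb
    rw [← continuousOn_univ]
    exact (hcont d).comp (f := fun t : ℝ => (b, t)) (by fun_prop) (fun t _ => hb)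
  have hopen : IsOpen {b : ℂ | 0 < b.im} := isOpen_lt continuous_const Complex.continuous_im
  obtain ⟨r, hr, hball⟩ := Metric.nhds_basis_closedBall.mem_iff.1 (hopen.mem_nhds hb₀)
  obtain ⟨C, hC⟩ := (((isCompact_closedBall b₀ r).prod
      (isCompact_Icc (a := (0 : ℝ)) (b := Real.pi / 2)))).exists_bound_of_continuousOn
    (f := fun x : ℂ × ℝ => (Real.cos x.2 : ℂ) ^ p * (Real.sin x.2 : ℂ) ^ k *
          (c * WW a x.1 x.2 ^ (c - 1) * (Real.sin x.2 : ℂ) ^ 2)) (by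
      have h1 := (hcont (c - 1)).mono (s := {x : ℂ × ℝ | 0 < x.1.im})
        (t := Metric.closedBall b₀ r ×ˢ Set.Icc (0 : ℝ) (Real.pi / 2)) (fun x hx => hball hx.1)
      fun_prop)
  refine (intervalIntegral.hasDerivAt_integral_of_dominated_loc_of_deriv_le
    (F := fun b t => (Real.cos t : ℂ) ^ p * (Real.sin t : ℂ) ^ k * WW a b t ^ c)
    (F' := fun b t => (Real.cos t : ℂ) ^ p * (Real.sin t : ℂ) ^ k *
          (c * WW a b t ^ (c - 1) * (Real.sin t : ℂ) ^ 2)) (bound := fun _ => C)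
    (Metric.closedBall_mem_nhds b₀ hr) ?_ ?_ ?_ ?_ ?_ ?_).2
  · filter_upwards [hopen.mem_nhds hb₀] with b hb
    have := hcont1 c b hb
    exact Continuous.aestronglyMeasurable (by fun_prop)
  · have := hcont1 c b₀ hb₀
    exact Continuous.intervalIntegrable (by fun_prop) _ _
  · have := hcont1 (c - 1) b₀ hb₀
    exact Continuous.aestronglyMeasurable (by fun_prop)
  · refine Eventually.of_forall fun t ht b hb => hC (b, t) ⟨hb, ?_⟩
    rw [Set.uIoc_of_le (by positivity)] at ht
    exact ⟨ht.1.le, ht.2⟩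
  · exact intervalIntegrable_const
  · refine Eventually.of_forall fun t ht b hb => ?_
    have hW : HasDerivAt (fun b : ℂ => WW a b t) ((Real.sin t : ℂ) ^ 2) b := by
      unfold WW
      simpa using ((hasDerivAt_id b).mul_const ((Real.sin t : ℂ) ^ 2)).const_add
        (a * (Real.cos t : ℂ) ^ 2)
    exact (hW.cpow_const (WW_slit ha (hball hb) t)).const_mul _

/-- The integral of the total derivative vanishes. -/
lemma GG_ibp (a b : ℂ) (ha : 0 < a.im) (hb : 0 < b.im) (p k : ℕ) (c : ℂ)
    (hc : c = -((p : ℂ) + k + 2) / 2) :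
    ((k : ℂ) + 1) / 2 * (∫ t in (0 : ℝ)..(Real.pi / 2),
        (Real.cos t : ℂ) ^ p * (Real.sin t : ℂ) ^ k * WW a b t ^ c) +
      b * (∫ t in (0 : ℝ)..(Real.pi / 2),
        (Real.cos t : ℂ) ^ p * (Real.sin t : ℂ) ^ k *
          (c * WW a b t ^ (c - 1) * (Real.sin t : ℂ) ^ 2)) = 0 := by
  have hcont1 : ∀ d : ℂ, Continuous (fun t : ℝ => WW a b t ^ d) := by
    intro d
    have h0 : Continuous (fun t : ℝ => WW a b t) := by unfold WW; fun_prop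
    exact continuous_iff_continuousAt.2 fun t =>
      (continuousAt_cpow_const (WW_slit ha hb t)).comp h0.continuousAt
  have hc0 := hcont1 c
  have hc1 := hcont1 (c - 1)
  rw [← intervalIntegral.integral_const_mul, ← intervalIntegral.integral_const_mul,
    ← intervalIntegral.integral_add (Continuous.intervalIntegrable (by fun_prop) _ _)
      (Continuous.intervalIntegrable (by fun_prop) _ _)]
  rw [intervalIntegral.integral_eq_sub_of_hasDerivAt (f := fun t : ℝ =>
    (1 / 2 : ℂ) * ((Real.sin t : ℂ) ^ (k + 1) * (Real.cos t : ℂ) ^ (p + 1) * WW a b t ^ c))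
    _ (Continuous.intervalIntegrable (by fun_prop) _ _)]
  · simp
  · intro t _
    have hs : HasDerivAt (fun t : ℝ => (Real.sin t : ℂ)) (Real.cos t : ℂ) t :=
      (Real.hasDerivAt_sin t).ofReal_comp
    have hco : HasDerivAt (fun t : ℝ => (Real.cos t : ℂ)) (-(Real.sin t : ℂ)) t := by
      simpa using (Real.hasDerivAt_cos t).ofReal_comp
    have hW : HasDerivAt (fun t : ℝ => WW a b t)
        (2 * (b - a) * (Real.sin t : ℂ) * (Real.cos t : ℂ)) t := by
      unfold WW
      refine (((hco.fun_pow 2).const_mul a).fun_add ((hs.fun_pow 2).const_mul b)).congr_deriv ?_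
      simp only [Nat.cast_ofNat, Nat.add_one_sub_one, pow_one]
      ring
    have hWc : HasDerivAt (fun t : ℝ => WW a b t ^ c)
        (c * WW a b t ^ (c - 1) * (2 * (b - a) * (Real.sin t : ℂ) * (Real.cos t : ℂ))) t := 
      (((hasDerivAt_id (WW a b t)).cpow_const (c := c) (WW_slit ha hb t)).comp t hW).congr_deriv
        (by simp)
    refine ((((hs.fun_pow (k + 1)).fun_mul (hco.fun_pow (p + 1))).fun_mul hWc).const_mul
      (1 / 2 : ℂ)).congr_deriv ?_
    have hpow : WW a b t ^ c = WW a b t ^ (c - 1) * WW a b t := by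
      rw [Complex.cpow_sub _ _ (Complex.slitPlane_ne_zero (WW_slit ha hb t)), Complex.cpow_one,
        div_mul_cancel₀ _ (Complex.slitPlane_ne_zero (WW_slit ha hb t))]
    have h : (Real.cos t : ℂ) ^ 2 + (Real.sin t : ℂ) ^ 2 = 1 := by
      exact_mod_cast Real.cos_sq_add_sin_sq t
    rw [hpow]
    generalize WW a b t ^ (c - 1) = V
    unfold WW
    generalize (Real.cos t : ℂ) = x at *
    generalize (Real.sin t : ℂ) = y at *
    subst hc
    push_cast
    linear_combination ((x ^ p * y ^ k * V * (((k : ℂ) + 1) / 2 * (a * x ^ 2 + b * y ^ 2) +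
      (-((p : ℂ) + k + 2) / 2) * b * y ^ 2))) * h

lemma GG_value (a b : ℂ) (ha : 0 < a.im) (hb : 0 < b.im) (p k : ℕ) (c : ℂ)
    (hc : c = -((p : ℂ) + k + 2) / 2) :
    b ^ (((k : ℂ) + 1) / 2) * (∫ t in (0 : ℝ)..(Real.pi / 2),
        (Real.cos t : ℂ) ^ p * (Real.sin t : ℂ) ^ k * WW a b t ^ c) =
    a ^ (((k : ℂ) + 1) / 2) * ((∫ t in (0 : ℝ)..(Real.pi / 2),
        (Real.cos t : ℂ) ^ p * (Real.sin t : ℂ) ^ k) * a ^ c) := by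
  have hopen : IsOpen {b : ℂ | 0 < b.im} := isOpen_lt continuous_const Complex.continuous_im
  have hconv : Convex ℝ {b : ℂ | 0 < b.im} := convex_halfSpace_im_gt 0
  have hd : ∀ b ∈ {b : ℂ | 0 < b.im}, HasDerivAt (fun b : ℂ => b ^ (((k : ℂ) + 1) / 2) *
      (∫ t in (0 : ℝ)..(Real.pi / 2),
        (Real.cos t : ℂ) ^ p * (Real.sin t : ℂ) ^ k * WW a b t ^ c)) 0 b := by
    intro b hb
    have hbs : b ∈ Complex.slitPlane := Or.inr (ne_of_gt hb)
    refine (((hasDerivAt_id' b).cpow_const (c := ((k : ℂ) + 1) / 2) hbs).fun_mul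
      (GG_deriv a ha p k c b hb)).congr_deriv ?_
    have h1 := GG_ibp a b ha hb p k c hc
    have hpow : b ^ (((k : ℂ) + 1) / 2) = b ^ (((k : ℂ) + 1) / 2 - 1) * b := by
      rw [Complex.cpow_sub _ _ (Complex.slitPlane_ne_zero hbs), Complex.cpow_one,
        div_mul_cancel₀ _ (Complex.slitPlane_ne_zero hbs)]
    rw [hpow]
    linear_combination (b ^ (((k : ℂ) + 1) / 2 - 1)) * h1
  have := hopen.is_const_of_deriv_eq_zero hconv.isPreconnected
    (fun b hb => (hd b hb).differentiableAt.differentiableWithinAt)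
    (fun b hb => (hd b hb).deriv) (x := b) (y := a) hb ha
  rw [this]
  simp only [WW_self, intervalIntegral.integral_mul_const]

lemma sq_cpow_aux (s : ℝ) (hs : 0 < s) (n : ℕ) :
    (s : ℂ) * ((s ^ 2 : ℝ) : ℂ) ^ (((n : ℂ) + 1) / 2 - 1) = (s : ℂ) ^ n := by
  have h1 : (((n : ℂ) + 1) / 2 - 1) = (((n : ℝ) - 1) / 2 : ℝ) := by push_cast; ring
  rw [h1, ← Complex.ofReal_cpow (by positivity)]
  rw [← Complex.ofReal_mul, ← Complex.ofReal_pow]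
  congr 1
  have : s ^ 2 = s ^ (2 : ℝ) := by norm_cast
  rw [this, ← Real.rpow_mul hs.le]
  have h2 : (2 : ℝ) * (((n : ℝ) - 1) / 2) = n - 1 := by ring
  rw [h2, Real.rpow_sub_one hs.ne', Real.rpow_natCast]
  field_simp

lemma beta_trig (p k : ℕ) :
    Complex.betaIntegral (((k : ℂ) + 1) / 2) (((p : ℂ) + 1) / 2) =
      2 * ∫ t in (0 : ℝ)..(Real.pi / 2), (Real.cos t : ℂ) ^ p * (Real.sin t : ℂ) ^ k := by
  have hpi := Real.pi_pos
  have himg : (fun t : ℝ => Real.sin t ^ 2) '' Set.Ioo 0 (Real.pi / 2) = Set.Ioo 0 1 := by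
    ext x
    constructor
    · rintro ⟨t, ⟨h0, h1⟩, rfl⟩
      have hs := Real.sin_pos_of_pos_of_lt_pi h0 (by linarith)
      have hc := Real.cos_pos_of_mem_Ioo ⟨by linarith, h1⟩
      have := Real.sin_sq_add_cos_sq t
      exact ⟨by positivity, by dsimp only; nlinarith⟩
    · rintro ⟨h0, h1⟩
      have hq0 : 0 < Real.sqrt x := Real.sqrt_pos.2 h0
      have hq1 : Real.sqrt x < 1 := by
        rw [Real.sqrt_lt' one_pos]; simpa using h1
      refine ⟨Real.arcsin (Real.sqrt x), ⟨Real.arcsin_pos.2 hq0,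
        Real.arcsin_lt_pi_div_two.2 hq1⟩, ?_⟩
      simp only
      rw [Real.sin_arcsin (by linarith) hq1.le, Real.sq_sqrt h0.le]
  have hinj : Set.InjOn (fun t : ℝ => Real.sin t ^ 2) (Set.Ioo 0 (Real.pi / 2)) := by
    intro t ht u hu htu
    have h1 := Real.sin_pos_of_pos_of_lt_pi ht.1 (by linarith [ht.2])
    have h2 := Real.sin_pos_of_pos_of_lt_pi hu.1 (by linarith [hu.2])
    have h3 : Real.sin t = Real.sin u := by
      exact (pow_left_inj₀ h1.le h2.le two_ne_zero).1 htu
    exact Real.injOn_sin ⟨by linarith [ht.1], ht.2.le⟩ ⟨by linarith [hu.1], hu.2.le⟩ h3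
  have hder : ∀ t ∈ Set.Ioo 0 (Real.pi / 2), HasDerivWithinAt (fun t : ℝ => Real.sin t ^ 2)
      (2 * Real.sin t * Real.cos t) (Set.Ioo 0 (Real.pi / 2)) t := by
    intro t _
    simpa using ((Real.hasDerivAt_sin t).fun_pow 2).hasDerivWithinAt
  rw [Complex.betaIntegral, intervalIntegral.integral_of_le zero_le_one,
    MeasureTheory.integral_Ioc_eq_integral_Ioo, ← himg,
    MeasureTheory.integral_image_eq_integral_abs_deriv_smul measurableSet_Ioo hder hinj,
    intervalIntegral.integral_of_le (by positivity), MeasureTheory.integral_Ioc_eq_integral_Ioo,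
    ← MeasureTheory.integral_const_mul]
  refine MeasureTheory.setIntegral_congr_fun measurableSet_Ioo fun t ht => ?_
  have h1 := Real.sin_pos_of_pos_of_lt_pi ht.1 (by linarith [ht.2])
  have h2 := Real.cos_pos_of_mem_Ioo ⟨by linarith [ht.1], ht.2⟩
  have h3 : (1 : ℂ) - ((Real.sin t ^ 2 : ℝ) : ℂ) = ((Real.cos t ^ 2 : ℝ) : ℂ) := by
    rw [Real.cos_sq']; push_cast; ring
  rw [h3, abs_of_pos (by positivity), Complex.real_smul, ← sq_cpow_aux _ h1 k,
    ← sq_cpow_aux _ h2 p]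
  push_cast
  ring

lemma trig_val (p k : ℕ) :
    (∫ t in (0 : ℝ)..(Real.pi / 2), (Real.cos t : ℂ) ^ p * (Real.sin t : ℂ) ^ k) =
      ((omegaN (p + (k + 1)) / (omegaN p * omegaN k) : ℝ) : ℂ) := by
  have h1 := beta_trig p k
  have hk : (0 : ℝ) < ((k : ℝ) + 1) / 2 := by positivity
  have hp : (0 : ℝ) < ((p : ℝ) + 1) / 2 := by positivity
  have h2 := Complex.betaIntegral_eq_Gamma_mul_div (((((k : ℝ) + 1) / 2 : ℝ)) : ℂ)
    (((((p : ℝ) + 1) / 2 : ℝ)) : ℂ) (by simpa using hk) (by simpa using hp)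
  rw [← Complex.ofReal_add, Complex.Gamma_ofReal, Complex.Gamma_ofReal, Complex.Gamma_ofReal] at h2
  have h3 : omegaN (p + (k + 1)) / (omegaN p * omegaN k) =
      (Real.Gamma (((k : ℝ) + 1) / 2) * Real.Gamma (((p : ℝ) + 1) / 2) /
        Real.Gamma (((k : ℝ) + 1) / 2 + ((p : ℝ) + 1) / 2)) / 2 := by
    unfold omegaN
    have e : (((p + (k + 1) : ℕ) : ℝ) + 1) / 2 = ((k : ℝ) + 1) / 2 + ((p : ℝ) + 1) / 2 := by
      push_cast; ring
    rw [e, Real.rpow_add Real.pi_pos]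
    have g1 := (Real.Gamma_pos_of_pos hk).ne'
    have g2 := (Real.Gamma_pos_of_pos hp).ne'
    have g3 := (Real.Gamma_pos_of_pos (add_pos hk hp)).ne'
    have g4 := (Real.rpow_pos_of_pos Real.pi_pos (((k : ℝ) + 1) / 2)).ne'
    have g5 := (Real.rpow_pos_of_pos Real.pi_pos (((p : ℝ) + 1) / 2)).ne'
    field_simp
    try norm_num
  rw [h3]
  push_cast at h2
  rw [Complex.ofReal_div, Complex.ofReal_div, Complex.ofReal_mul, ← h2, h1]
  simp

/-- evaluation of the constant `C_{p,q}`: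
`lim_{ε→0⁺} ∫_0^{π/2} cos^p θ sin^{q-1} θ (cos 2θ + iε)^{-(p+q+1)/2} dθ
  = (-i)^q ω_{p+q} / (ω_p ω_{q-1})`,
where the half-integer power is `(w^{1/2})^{-(p+q+1)}` with `w^{1/2}` the square root
with positive real part. -/
theorem Cpq_value (p q : ℕ) (hp : 1 ≤ p) (hq : 1 ≤ q) (hpq : 2 ≤ p + q) :
    Tendsto (fun ε : ℝ =>
        ∫ θ in (0 : ℝ)..(Real.pi / 2),
          ((Real.cos θ ^ p * Real.sin θ ^ (q - 1) : ℝ) : ℂ) *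
            ((((Real.cos (2 * θ) : ℝ) : ℂ) + (ε : ℂ) * Complex.I) ^ ((1 : ℂ) / 2))
              ^ (-((p : ℤ) + (q : ℤ) + 1)))
      (nhdsWithin 0 (Set.Ioi 0))
      (nhds ((-Complex.I) ^ q *
        ((omegaN (p + q) / (omegaN p * omegaN (q - 1)) : ℝ) : ℂ))) := by
  obtain ⟨k, rfl⟩ : ∃ k, q = k + 1 := ⟨q - 1, by omega⟩
  simp only [Nat.add_sub_cancel]
  rw [← trig_val]
  set B := ∫ t in (0 : ℝ)..(Real.pi / 2), (Real.cos t : ℂ) ^ p * (Real.sin t : ℂ) ^ k with hB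
  set c : ℂ := -((p : ℂ) + k + 2) / 2 with hc
  have hlog : Tendsto (fun ε : ℝ => Complex.log (-1 + ε * Complex.I)) (nhdsWithin 0 (Set.Ioi 0))
      (nhds (Real.pi * Complex.I)) := by
    have h := (Complex.continuousWithinAt_log_of_re_neg_of_im_zero (z := -1) (by simp)
      (by simp)).tendsto
    rw [Complex.log_neg_one] at h
    refine h.comp (tendsto_nhdsWithin_iff.2 ⟨?_, ?_⟩)
    · have : Continuous (fun ε : ℝ => (-1 + ε * Complex.I : ℂ)) := by fun_prop
      simpa using (this.tendsto 0).mono_left nhdsWithin_le_nhds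
    · filter_upwards [self_mem_nhdsWithin] with ε hε
      simpa using le_of_lt hε
  have hlog1 : Tendsto (fun ε : ℝ => Complex.log (1 + ε * Complex.I)) (nhdsWithin 0 (Set.Ioi 0))
      (nhds 0) := by
    have : ContinuousAt (fun ε : ℝ => Complex.log (1 + ε * Complex.I)) 0 := by
      apply ContinuousAt.clog
      · fun_prop
      · simp
    simpa using this.tendsto.mono_left nhdsWithin_le_nhds
  have hlim : Tendsto (fun ε : ℝ =>
      Complex.exp (-(Complex.log (-1 + ε * Complex.I) * (((k : ℂ) + 1) / 2))) *
      (Complex.exp (Complex.log (1 + ε * Complex.I) * (((k : ℂ) + 1) / 2)) *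
        (B * Complex.exp (Complex.log (1 + ε * Complex.I) * c)))) (nhdsWithin 0 (Set.Ioi 0))
      (nhds (Complex.exp (-(Real.pi * Complex.I * (((k : ℂ) + 1) / 2))) *
        (Complex.exp (0 * (((k : ℂ) + 1) / 2)) * (B * Complex.exp (0 * c))))) :=
    ((hlog.mul_const _).neg.cexp).mul (((hlog1.mul_const _).cexp).mul
      (((hlog1.mul_const _).cexp).const_mul _))
  have hval : Complex.exp (-(Real.pi * Complex.I * (((k : ℂ) + 1) / 2))) *
        (Complex.exp (0 * (((k : ℂ) + 1) / 2)) * (B * Complex.exp (0 * c))) =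
      (-Complex.I) ^ (k + 1) * B := by
    have : Complex.exp (-(Real.pi * Complex.I * (((k : ℂ) + 1) / 2))) =
        (-Complex.I) ^ (k + 1) := by
      rw [← Complex.exp_neg_pi_div_two_mul_I, ← Complex.exp_nat_mul]
      congr 1
      push_cast
      ring
    rw [this]
    simp
  rw [hval] at hlim
  refine hlim.congr' ?_
  filter_upwards [self_mem_nhdsWithin] with ε hε
  have hε' : 0 < ε := hε
  set a : ℂ := 1 + ε * Complex.I with ha
  set b : ℂ := -1 + ε * Complex.I with hb
  have ha0 : 0 < a.im := by simpa [ha] using hε'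
  have hb0 : 0 < b.im := by simpa [hb] using hε'
  have hane : a ≠ 0 := fun h => by simp [h] at ha0
  have hbne : b ≠ 0 := fun h => by simp [h] at hb0
  have key := GG_value a b ha0 hb0 p k c hc
  rw [← hB] at key
  have hint : ∀ θ : ℝ, ((Real.cos θ ^ p * Real.sin θ ^ k : ℝ) : ℂ) *
            ((((Real.cos (2 * θ) : ℝ) : ℂ) + (ε : ℂ) * Complex.I) ^ ((1 : ℂ) / 2))
              ^ (-((p : ℤ) + ((k + 1 : ℕ) : ℤ) + 1)) =
      (Real.cos θ : ℂ) ^ p * (Real.sin θ : ℂ) ^ k * WW a b θ ^ c := by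
    intro θ
    have h : (Real.cos θ : ℂ) ^ 2 + (Real.sin θ : ℂ) ^ 2 = 1 := by
      exact_mod_cast Real.cos_sq_add_sin_sq θ
    have hW : ((Real.cos (2 * θ) : ℝ) : ℂ) + (ε : ℂ) * Complex.I = WW a b θ := by
      rw [Real.cos_two_mul, WW, ha, hb]
      push_cast at h ⊢
      linear_combination (1 - (ε : ℂ) * Complex.I) * h
    rw [hW, ← Complex.cpow_mul_int]
    have hcc : (1 : ℂ) / 2 * ((-((p : ℤ) + ((k + 1 : ℕ) : ℤ) + 1) : ℤ) : ℂ) = c := by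
      rw [hc]; push_cast; ring
    rw [hcc]
    push_cast
    ring
  simp only [hint]
  rw [Complex.exp_neg, ← Complex.cpow_def_of_ne_zero hane, ← Complex.cpow_def_of_ne_zero hane,
    ← Complex.cpow_def_of_ne_zero hbne, ← key, inv_mul_cancel_left₀]
  rw [Complex.cpow_def_of_ne_zero hbne]
  exact Complex.exp_ne_zero _

end
end
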